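/- arXiv:2204.01315 — 8 statements merged into one kernel-verified Lean document; each statement's English description precedes it below -/
import Mathlib

section
/- Suppose the feasible set Ω := {(x,y) ∈ X × Y : A*x + B*y = c} is nonempty. Then (x̄, ȳ) ∈ X × Y minimizes f1(x)+f2(x)+h1(y)+h2(y) over Ω if and only if there exists z̄ ∈ Z such that −∇f1(x̄) − A z̄ ∈ ∂f2(x̄), −∇h1(ȳ) − B z̄ ∈ ∂h2(ȳ), and A*x̄ + B*ȳ = c. -/
open scoped InnerProductSpace

/-- `v` is a subgradient of the convex function `f` at `x`:
`f w ≥ f x + ⟪v, w - x⟫` for all `w`. -/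
def IsSubgrad {E : Type*} [NormedAddCommGroup E] [InnerProductSpace ℝ E]
    (f : E → ℝ) (v x : E) : Prop := ∀ w, f x + ⟪v, w - x⟫_ℝ ≤ f w

open Filter Topology

theorem IsSubgrad.sub_of_hasGradientAt {E : Type*} [NormedAddCommGroup E] [InnerProductSpace ℝ E]
    [CompleteSpace E] {p q : E → ℝ} {v g x : E} (h : IsSubgrad (fun w => p w + q w) v x)
    (hp : HasGradientAt p g x) (hq : ConvexOn ℝ Set.univ q) : IsSubgrad q (v - g) x := by
  intro w
  have hlim : Tendsto (fun t : ℝ => t⁻¹ * (p (x + t • (w - x)) - p x)) (𝓝[>] 0)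
      (𝓝 ⟪g, w - x⟫_ℝ) := by
    have := (hp.hasFDerivAt.hasLineDerivAt (w - x)).tendsto_slope_zero_right
    simpa using this
  have hle : ∀ᶠ t : ℝ in 𝓝[>] 0,
      ⟪v, w - x⟫_ℝ - (q w - q x) ≤ t⁻¹ * (p (x + t • (w - x)) - p x) := by
    filter_upwards [Ioo_mem_nhdsGT (zero_lt_one (α := ℝ))] with t ht
    obtain ⟨ht0, ht1⟩ := ht
    have h1 := h (x + t • (w - x))
    have h2 := hq.2 (Set.mem_univ x) (Set.mem_univ w) (sub_nonneg.2 ht1.le) ht0.le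
      (sub_add_cancel 1 t)
    have h3 : (1 - t) • x + t • w = x + t • (w - x) := by module
    rw [h3] at h2
    simp only [add_sub_cancel_left, real_inner_smul_right, smul_eq_mul] at h1 h2
    rw [inv_mul_eq_div, le_div_iff₀ ht0]
    linarith
  have := ge_of_tendsto hlim hle
  rw [inner_sub_left]
  linarith

theorem ConvexOn.isSubgrad_gradient {E : Type*} [NormedAddCommGroup E] [InnerProductSpace ℝ E]
    [CompleteSpace E] {f : E → ℝ} {x : E} (hf : ConvexOn ℝ Set.univ f)
    (hd : DifferentiableAt ℝ f x) : IsSubgrad f (gradient f x) x := by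
  have hg : HasGradientAt (fun w => -f w) (-gradient f x) x := by
    rw [hasGradientAt_iff_hasFDerivAt, map_neg]
    exact hd.hasGradientAt.hasFDerivAt.neg
  have h0 : IsSubgrad (fun w => -f w + f w) 0 x := fun w => by simp
  simpa using h0.sub_of_hasGradientAt hg hf

/-- A convex function that is minimal at `x` along a subspace has a supporting affine function
at `x` which is constant along that subspace. -/
theorem ConvexOn.exists_support_of_isMin_submodule {E : Type*} [NormedAddCommGroup E]
    [NormedSpace ℝ E] [FiniteDimensional ℝ E] {φ : E → ℝ} (hφ : ConvexOn ℝ Set.univ φ)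
    (K : Submodule ℝ E) {x : E} (hmin : ∀ k ∈ K, φ x ≤ φ (x + k)) :
    ∃ g : E →L[ℝ] ℝ, (∀ k ∈ K, g k = 0) ∧ ∀ w, φ x + g (w - x) ≤ φ w := by
  have hcont : Continuous φ :=
    continuousOn_univ.1 (hφ.continuousOn isOpen_univ)
  have hsc : Convex ℝ {p : E × ℝ | φ p.1 < p.2} := by
    simpa using hφ.convex_strict_epigraph
  have hso : IsOpen {p : E × ℝ | φ p.1 < p.2} :=
    isOpen_lt (hcont.comp continuous_fst) continuous_snd
  have htc : Convex ℝ {p : E × ℝ | p.1 - x ∈ K ∧ p.2 = φ x} := by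
    rintro ⟨a, r⟩ ⟨ha, hr⟩ ⟨b, s⟩ ⟨hb, hs⟩ α β - - hαβ
    simp only at ha hr hb hs
    refine ⟨?_, ?_⟩
    · have : α • a + β • b - x = α • (a - x) + β • (b - x) := by
        have : x = (α + β) • x := by rw [hαβ, one_smul]
        nth_rewrite 1 [this]
        module
      simpa [this] using K.add_mem (K.smul_mem α ha) (K.smul_mem β hb)
    · simp [hr, hs, ← add_mul, hαβ]
  have hdisj : Disjoint {p : E × ℝ | φ p.1 < p.2} {p : E × ℝ | p.1 - x ∈ K ∧ p.2 = φ x} := by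
    rw [Set.disjoint_left]
    rintro ⟨a, r⟩ h1 ⟨h2, h3⟩
    have := hmin _ h2
    simp only [Set.mem_ofPred_eq, add_sub_cancel] at h1 h3 this
    linarith
  obtain ⟨F, u, hFs, hFt⟩ := geometric_hahn_banach_open hsc hso htc hdisj
  set G : E →L[ℝ] ℝ := F.comp (ContinuousLinearMap.inl ℝ E ℝ) with hG
  set ρ : ℝ := F (0, 1) with hρ
  have hF : ∀ a r, F (a, r) = G a + r * ρ := by
    intro a r
    have : (a, r) = ((a, 0) : E × ℝ) + r • ((0, 1) : E × ℝ) := by simp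
    rw [this, map_add, map_smul]
    simp [hG, hρ]
  have hlt : ∀ a r, φ a < r → G a + r * ρ < u := fun a r h => hF a r ▸ hFs (a, r) h
  have hge : ∀ k ∈ K, u ≤ G x + G k + φ x * ρ := fun k hk => by
    have := hFt (x + k, φ x) ⟨by simpa using hk, rfl⟩
    rwa [hF, map_add] at this
  have hge0 := hge 0 K.zero_mem
  rw [map_zero, add_zero] at hge0
  have hρneg : ρ < 0 := by
    have := hlt x (φ x + 1) (by linarith)
    linarith
  have hle : ∀ w, G w + φ w * ρ ≤ G x + φ x * ρ := by
    intro w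
    refine le_of_forall_pos_le_add fun ε hε => ?_
    have := hlt w (φ w + ε / (-ρ)) (by have := div_pos hε (neg_pos.2 hρneg); linarith)
    have h2 : ε / (-ρ) * ρ = -ε := by rw [div_neg, neg_mul, div_mul_cancel₀ _ hρneg.ne]
    rw [add_mul, h2] at this
    linarith
  refine ⟨(-ρ)⁻¹ • G, fun k hk => ?_, fun w => ?_⟩
  · have hGk : G k = 0 := by
      by_contra hne
      have := hge (((u - 1 - G x - φ x * ρ) / G k) • k) (K.smul_mem _ hk)
      rw [map_smul, smul_eq_mul, div_mul_cancel₀ _ hne] at this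
      linarith
    simp [hGk]
  · have h1 := hle w
    have h2 : (-ρ)⁻¹ * (G w - G x) ≤ φ w - φ x := by
      rw [inv_mul_eq_div, div_le_iff₀ (neg_pos.2 hρneg)]
      linarith
    simp only [smul_apply, map_sub, smul_eq_mul] at h2 ⊢
    linarith

/-- A functional that vanishes on the kernel of `T` is of the form `⟪z, T ·⟫`. -/
theorem exists_inner_eq_of_ker_le {E Z : Type*} [AddCommGroup E] [Module ℝ E]
    [NormedAddCommGroup Z] [InnerProductSpace ℝ Z] [FiniteDimensional ℝ Z]
    (T : E →ₗ[ℝ] Z) (g : E →ₗ[ℝ] ℝ) (h : ∀ k ∈ LinearMap.ker T, g k = 0) :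
    ∃ z : Z, ∀ w, g w = ⟪z, T w⟫_ℝ := by
  have hmem : g ∈ LinearMap.range T.dualMap := by
    rw [LinearMap.range_dualMap_eq_dualAnnihilator_ker, Submodule.mem_dualAnnihilator]
    exact h
  obtain ⟨ψ, rfl⟩ := hmem
  refine ⟨(InnerProductSpace.toDual ℝ Z).symm (LinearMap.toContinuousLinearMap ψ), fun w => ?_⟩
  rw [InnerProductSpace.toDual_symm_apply]
  rfl

theorem stmt_2 {X Y Z : Type*}
    [NormedAddCommGroup X] [InnerProductSpace ℝ X] [FiniteDimensional ℝ X]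
    [NormedAddCommGroup Y] [InnerProductSpace ℝ Y] [FiniteDimensional ℝ Y]
    [NormedAddCommGroup Z] [InnerProductSpace ℝ Z] [FiniteDimensional ℝ Z]
    (f1 f2 : X → ℝ) (h1 h2 : Y → ℝ)
    (hf1c : ConvexOn ℝ Set.univ f1) (hf1d : Differentiable ℝ f1)
    (hh1c : ConvexOn ℝ Set.univ h1) (hh1d : Differentiable ℝ h1)
    (hf2c : ConvexOn ℝ Set.univ f2) (hh2c : ConvexOn ℝ Set.univ h2)
    (A : Z →L[ℝ] X) (As : X →L[ℝ] Z) (B : Z →L[ℝ] Y) (Bs : Y →L[ℝ] Z)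
    (hA : ∀ (zz : Z) (xx : X), ⟪A zz, xx⟫_ℝ = ⟪zz, As xx⟫_ℝ)
    (hB : ∀ (zz : Z) (yy : Y), ⟪B zz, yy⟫_ℝ = ⟪zz, Bs yy⟫_ℝ)
    (c : Z)
    (hfeas : ∃ (x0 : X) (y0 : Y), As x0 + Bs y0 = c)
    (xb : X) (yb : Y) :
    (As xb + Bs yb = c ∧
      ∀ (x : X) (y : Y), As x + Bs y = c →
        f1 xb + f2 xb + h1 yb + h2 yb ≤ f1 x + f2 x + h1 y + h2 y) ↔
    ∃ zb : Z,
      IsSubgrad f2 (-gradient f1 xb - A zb) xb ∧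
      IsSubgrad h2 (-gradient h1 yb - B zb) yb ∧
      As xb + Bs yb = c := by
  constructor
  · rintro ⟨hb, hmin⟩
    have hφ : ConvexOn ℝ Set.univ
        (fun p : X × Y => (f1 p.1 + f2 p.1) + (h1 p.2 + h2 p.2)) :=
      ((hf1c.add hf2c).comp_linearMap (LinearMap.fst ℝ X Y)).add
        ((hh1c.add hh2c).comp_linearMap (LinearMap.snd ℝ X Y))
    obtain ⟨g, hgK, hg⟩ := hφ.exists_support_of_isMin_submodule
      (LinearMap.ker (As.toLinearMap.coprod Bs.toLinearMap)) (x := (xb, yb)) (by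
        rintro ⟨a, b⟩ hk
        have hk' : As a + Bs b = 0 := by simpa using hk
        have := hmin (xb + a) (yb + b) (by
          rw [map_add, map_add, add_add_add_comm, hk', hb, add_zero])
        simp only [Prod.mk_add_mk]
        linarith)
    obtain ⟨z, hz⟩ := exists_inner_eq_of_ker_le _ g.toLinearMap hgK
    have hz' : ∀ a b, g (a, b) = ⟪A z, a⟫_ℝ + ⟪B z, b⟫_ℝ := fun a b => by
      rw [hA, hB, ← inner_add_right]
      exact hz (a, b)
    have hX : IsSubgrad (fun w => f1 w + f2 w) (A z) xb := fun w => by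
      have := hg (w, yb)
      rw [Prod.mk_sub_mk, hz'] at this
      simp only [sub_self, inner_zero_right] at this ⊢
      linarith
    have hY : IsSubgrad (fun w => h1 w + h2 w) (B z) yb := fun w => by
      have := hg (xb, w)
      rw [Prod.mk_sub_mk, hz'] at this
      simp only [sub_self, inner_zero_right] at this ⊢
      linarith
    refine ⟨-z, ?_, ?_, hb⟩
    · have := hX.sub_of_hasGradientAt (hf1d xb).hasGradientAt hf2c
      rwa [map_neg, sub_neg_eq_add, neg_add_eq_sub]
    · have := hY.sub_of_hasGradientAt (hh1d yb).hasGradientAt hh2c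
      rwa [map_neg, sub_neg_eq_add, neg_add_eq_sub]
  · rintro ⟨z, hX, hY, hb⟩
    refine ⟨hb, fun x y hxy => ?_⟩
    have e1 := hX x
    have e2 := hY y
    have e3 := hf1c.isSubgrad_gradient (hf1d xb) x
    have e4 := hh1c.isSubgrad_gradient (hh1d yb) y
    have e5 : ⟪A z, x - xb⟫_ℝ + ⟪B z, y - yb⟫_ℝ = 0 := by
      rw [hA, hB, ← inner_add_right, map_sub, map_sub, sub_add_sub_comm, hxy, hb, sub_self,
        inner_zero_right]
    rw [inner_sub_left, inner_neg_left] at e1 e2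
    linarith
end

section
/- Suppose the sequences satisfy, for every k: z^k = z̃^k + σ(A*x^k + B*ỹ^k − c), ỹ^{k+1} = ỹ^k + ρ(y^k − ỹ^k), z̃^{k+1} = z̃^k + ρ(z^k − z̃^k), and suppose A*x̄ + B*ȳ = c. Then for every k, ⟨A*x_e^{k+1} + B*y_e^k, z_e^{k+1} + σ(ρ−1)A*x_e^{k+1}⟩ = (1/(2σρ))·(‖z_e^{k+1} + σ(ρ−1)A*x_e^{k+1}‖² − ‖z_e^k + σ(ρ−1)A*x_e^k‖²) + (σρ/2)‖A*x_e^{k+1} + B*y_e^k‖². -/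
open scoped InnerProductSpace

/-- If `v = u - t • w`, the squared norms of `u` and `v` determine `⟪w, u⟫`. -/
theorem inner_eq_of_eq_sub_smul {E : Type*} [NormedAddCommGroup E] [InnerProductSpace ℝ E]
    {t : ℝ} (ht : t ≠ 0) {u v w : E} (h : v = u - t • w) :
    ⟪w, u⟫_ℝ = (1 / (2 * t)) * (‖u‖ ^ 2 - ‖v‖ ^ 2) + (t / 2) * ‖w‖ ^ 2 := by
  rw [h, norm_sub_sq_real, inner_smul_right, norm_smul, mul_pow, Real.norm_eq_abs, sq_abs,
    real_inner_comm u w]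
  field_simp
  ring

theorem stmt_5 {X Y Z : Type*}
    [NormedAddCommGroup X] [InnerProductSpace ℝ X] [FiniteDimensional ℝ X]
    [NormedAddCommGroup Y] [InnerProductSpace ℝ Y] [FiniteDimensional ℝ Y]
    [NormedAddCommGroup Z] [InnerProductSpace ℝ Z] [FiniteDimensional ℝ Z]
    (A : Z →L[ℝ] X) (As : X →L[ℝ] Z) (B : Z →L[ℝ] Y) (Bs : Y →L[ℝ] Z)
    (hA : ∀ (zz : Z) (xx : X), ⟪A zz, xx⟫_ℝ = ⟪zz, As xx⟫_ℝ)
    (hB : ∀ (zz : Z) (yy : Y), ⟪B zz, yy⟫_ℝ = ⟪zz, Bs yy⟫_ℝ)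
    (c : Z) (σ ρ : ℝ) (hσ : 0 < σ) (hρ : ρ ∈ Set.Ioo (0 : ℝ) 2)
    (x : ℕ → X) (y : ℕ → Y) (z : ℕ → Z) (yt : ℕ → Y) (zt : ℕ → Z)
    (xb : X) (yb : Y) (zb : Z)
    (hz : ∀ k, z k = zt k + σ • (As (x k) + Bs (yt k) - c))
    (hyt : ∀ k, yt (k + 1) = yt k + ρ • (y k - yt k))
    (hzt : ∀ k, zt (k + 1) = zt k + ρ • (z k - zt k))
    (hfeas : As xb + Bs yb = c) :
    ∀ k, ⟪As (x (k + 1) - xb) + Bs (y k - yb),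
          (z (k + 1) - zb) + (σ * (ρ - 1)) • As (x (k + 1) - xb)⟫_ℝ =
      (1 / (2 * σ * ρ)) *
        (‖(z (k + 1) - zb) + (σ * (ρ - 1)) • As (x (k + 1) - xb)‖ ^ 2 -
         ‖(z k - zb) + (σ * (ρ - 1)) • As (x k - xb)‖ ^ 2) +
      (σ * ρ / 2) * ‖As (x (k + 1) - xb) + Bs (y k - yb)‖ ^ 2 := by
  intro k
  rw [mul_assoc 2 σ ρ]
  refine inner_eq_of_eq_sub_smul (mul_pos hσ hρ.1).ne' ?_
  have hztk : zt k = z k - σ • (As (x k) + Bs (yt k) - c) := eq_sub_of_add_eq (hz k).symm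
  rw [hz (k + 1), hzt, hyt, hztk, ← hfeas]
  simp only [map_add, map_sub, map_smul]
  module
end

section
/- Suppose the sequences satisfy, for every k: z^k = z̃^k + σ(A*x^k + B*ỹ^k − c), ỹ^{k+1} = ỹ^k + ρ(y^k − ỹ^k), z̃^{k+1} = z̃^k + ρ(z^k − z̃^k), and suppose A*x̄ + B*ȳ = c. Then for every k, ⟨B*y_e^k, (z_e^k − z_e^{k+1}) + σ(A*x_e^k + B*y_e^k) − σ(ρ−1)A*x_e^{k+1}⟩ = (σ(2−ρ)/2)·(‖A*x_e^k + B*y_e^k‖² − ‖A*x_e^k‖²) − (σρ/2)·(‖A*x_e^{k+1} + B*y_e^k‖² − ‖A*x_e^{k+1}‖²). -/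
open scoped InnerProductSpace

theorem stmt_6 {X Y Z : Type*}
    [NormedAddCommGroup X] [InnerProductSpace ℝ X] [FiniteDimensional ℝ X]
    [NormedAddCommGroup Y] [InnerProductSpace ℝ Y] [FiniteDimensional ℝ Y]
    [NormedAddCommGroup Z] [InnerProductSpace ℝ Z] [FiniteDimensional ℝ Z]
    (A : Z →L[ℝ] X) (As : X →L[ℝ] Z) (B : Z →L[ℝ] Y) (Bs : Y →L[ℝ] Z)
    (hA : ∀ (zz : Z) (xx : X), ⟪A zz, xx⟫_ℝ = ⟪zz, As xx⟫_ℝ)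
    (hB : ∀ (zz : Z) (yy : Y), ⟪B zz, yy⟫_ℝ = ⟪zz, Bs yy⟫_ℝ)
    (c : Z) (σ ρ : ℝ) (hσ : 0 < σ) (hρ : ρ ∈ Set.Ioo (0 : ℝ) 2)
    (x : ℕ → X) (y : ℕ → Y) (z : ℕ → Z) (yt : ℕ → Y) (zt : ℕ → Z)
    (xb : X) (yb : Y) (zb : Z)
    (hz : ∀ k, z k = zt k + σ • (As (x k) + Bs (yt k) - c))
    (hyt : ∀ k, yt (k + 1) = yt k + ρ • (y k - yt k))
    (hzt : ∀ k, zt (k + 1) = zt k + ρ • (z k - zt k))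
    (hfeas : As xb + Bs yb = c) :
    ∀ k, ⟪Bs (y k - yb),
          ((z k - zb) - (z (k + 1) - zb)) + σ • (As (x k - xb) + Bs (y k - yb)) -
            (σ * (ρ - 1)) • As (x (k + 1) - xb)⟫_ℝ =
      (σ * (2 - ρ) / 2) *
        (‖As (x k - xb) + Bs (y k - yb)‖ ^ 2 - ‖As (x k - xb)‖ ^ 2) -
      (σ * ρ / 2) *
        (‖As (x (k + 1) - xb) + Bs (y k - yb)‖ ^ 2 - ‖As (x (k + 1) - xb)‖ ^ 2) := by
  intro k
  have hdir : ((z k - zb) - (z (k + 1) - zb)) + σ • (As (x k - xb) + Bs (y k - yb)) -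
      (σ * (ρ - 1)) • As (x (k + 1) - xb) =
      σ • ((2 - ρ) • As (x k - xb) - ρ • As (x (k + 1) - xb) + (1 - ρ) • Bs (y k - yb)) := by
    rw [hz (k + 1), hyt k, hzt k, hz k, ← hfeas]
    simp only [map_sub, map_add, map_smul]
    module
  rw [hdir, norm_add_sq_real, norm_add_sq_real]
  simp only [inner_add_right, inner_sub_right, real_inner_smul_right,
    real_inner_self_eq_norm_sq]
  rw [real_inner_comm (As (x k - xb)), real_inner_comm (As (x (k + 1) - xb))]
  ring
end

section
/- Let f1 : X → ℝ be differentiable with self-adjoint positive semidefinite operators Σ_{f1} ⪯ Σ̂_{f1} satisfying (1/2)‖x−x'‖²_{Σ_{f1}} ≤ f1(x) − f1(x') − ⟨x−x', ∇f1(x')⟩ ≤ (1/2)‖x−x'‖²_{Σ̂_{f1}} for all x, x', let f2 : X → ℝ be convex, and let x^{k+1}, x̃^{k+1} ∈ X, z^{k+1} ∈ Z satisfy the first-order condition −∇f1(x̃^{k+1}) − (Σ̂_{f1}+S)(x^{k+1} − x̃^{k+1}) − A z^{k+1} ∈ ∂f2(x^{k+1}). Then for every x ∈ X: f1(x) − f1(x^{k+1})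 + f2(x) − f2(x^{k+1}) + ⟨x − x^{k+1}, A z^{k+1} − (Σ̂_{f1}+S)(x̃^{k+1} − x^{k+1})⟩ ≥ (1/2)‖x − x̃^{k+1}‖²_{Σ_{f1}} − (1/2)‖x̃^{k+1} − x^{k+1}‖²_{Σ̂_{f1}}. -/
open scoped InnerProductSpace

/-- The quadratic form `‖u‖_G² := ⟪u, G u⟫` associated with a linear operator `G`. -/
noncomputable def qf {E : Type*} [NormedAddCommGroup E] [InnerProductSpace ℝ E]
    (G : E →L[ℝ] E) (u : E) : ℝ := ⟪u, G u⟫_ℝ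

theorem stmt_8 {X Z : Type*}
    [NormedAddCommGroup X] [InnerProductSpace ℝ X] [FiniteDimensional ℝ X]
    [NormedAddCommGroup Z] [InnerProductSpace ℝ Z] [FiniteDimensional ℝ Z]
    (f1 : X → ℝ) (hf1d : Differentiable ℝ f1)
    (Sf Sfh : X →L[ℝ] X)
    (hSfsa : ∀ u v : X, ⟪Sf u, v⟫_ℝ = ⟪u, Sf v⟫_ℝ)
    (hSfhsa : ∀ u v : X, ⟪Sfh u, v⟫_ℝ = ⟪u, Sfh v⟫_ℝ)
    (hSfpsd : ∀ u : X, 0 ≤ ⟪u, Sf u⟫_ℝ)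
    (hSfhpsd : ∀ u : X, 0 ≤ ⟪u, Sfh u⟫_ℝ)
    (hle : ∀ u : X, 0 ≤ ⟪u, (Sfh - Sf) u⟫_ℝ)
    (hlow : ∀ x x' : X,
      (1 / 2) * qf Sf (x - x') ≤ f1 x - f1 x' - ⟪x - x', gradient f1 x'⟫_ℝ)
    (hupp : ∀ x x' : X,
      f1 x - f1 x' - ⟪x - x', gradient f1 x'⟫_ℝ ≤ (1 / 2) * qf Sfh (x - x'))
    (f2 : X → ℝ) (hf2c : ConvexOn ℝ Set.univ f2)
    (S : X →L[ℝ] X)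
    (hSsa : ∀ u v : X, ⟪S u, v⟫_ℝ = ⟪u, S v⟫_ℝ)
    (hSpsd : ∀ u : X, 0 ≤ ⟪u, S u⟫_ℝ)
    (A : Z →L[ℝ] X) (As : X →L[ℝ] Z)
    (hA : ∀ (zz : Z) (xx : X), ⟪A zz, xx⟫_ℝ = ⟪zz, As xx⟫_ℝ)
    (xk1 xt1 : X) (zk1 : Z)
    (hfoc : IsSubgrad f2
      (-gradient f1 xt1 - (Sfh + S) (xk1 - xt1) - A zk1) xk1) :
    ∀ x : X,
      f1 x - f1 xk1 + f2 x - f2 xk1 +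
        ⟪x - xk1, A zk1 - (Sfh + S) (xt1 - xk1)⟫_ℝ ≥
      (1 / 2) * qf Sf (x - xt1) - (1 / 2) * qf Sfh (xt1 - xk1) := by
  intro x
  have hl := hlow x xt1
  have hu := hupp xk1 xt1
  have hf := hfoc x
  have hneg : qf Sfh (xk1 - xt1) = qf Sfh (xt1 - xk1) := by
    rw [← neg_sub xt1 xk1]
    simp only [qf, map_neg, inner_neg_left, inner_neg_right, neg_neg]
  have hM : (Sfh + S) (xk1 - xt1) = -(Sfh + S) (xt1 - xk1) := by
    rw [← map_neg, neg_sub]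
  rw [hM, real_inner_comm] at hf
  rw [hneg] at hu
  have hg : ⟪x - xt1, gradient f1 xt1⟫_ℝ =
      ⟪x - xk1, gradient f1 xt1⟫_ℝ + ⟪xk1 - xt1, gradient f1 xt1⟫_ℝ := by
    rw [← inner_add_left, sub_add_sub_cancel]
  simp only [inner_sub_right, inner_neg_right] at hf ⊢
  linarith
end

section
/- Let (x̄, ȳ, z̄) be a KKT point, and suppose x^{k+1}, x̃^{k+1}, z^{k+1} satisfy −∇f1(x̃^{k+1}) − (Σ̂_{f1}+S)(x^{k+1}−x̃^{k+1}) − A z^{k+1} ∈ ∂f2(x^{k+1}) and y^k, ỹ^k, z^k, x^k satisfy −∇h1(ỹ^k) − (Σ̂_{h1}+T)(y^k−ỹ^k) − B(z^k + σ(A*x^k + B*y^k − c)) ∈ ∂h2(y^k). Set η_k := ⟨A*x_e^{k+1}, z_e^{k+1}⟩ + ⟨B*y_e^k, z_e^k + σ(A*x^k + B*y^k − c)⟩. Then −η_k + ⟨x_e^{k+1}, (Σ̂_{f1}+S)(x̃^{k+1} − x^{k+1})⟩ + ⟨y_e^k, (Σ̂_{h1}+T)(ỹ^k − y^k)⟩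 ≥ (1/4)‖x̃^{k+1} − x^{k+1}‖²_{Σ_{f1}} + (1/4)‖ỹ^k − y^k‖²_{Σ_{h1}} − (1/2)‖x̃^{k+1} − x^{k+1}‖²_{Σ̂_{f1}} − (1/2)‖ỹ^k − y^k‖²_{Σ̂_{h1}}. -/
open scoped InnerProductSpace

/-- The parallelogram inequality for the seminorm of a positive semidefinite operator. -/
lemma qf_sub_le {E : Type*} [NormedAddCommGroup E] [InnerProductSpace ℝ E]
    (G : E →L[ℝ] E) (hG : ∀ u : E, 0 ≤ ⟪u, G u⟫_ℝ) (a b c : E) :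
    (1 / 2) * qf G (a - b) ≤ qf G (c - a) + qf G (b - c) := by
  have h := hG ((c - a) - (b - c))
  simp only [qf, map_sub, inner_sub_left, inner_sub_right] at h ⊢
  linarith

/-- A three-point monotonicity estimate for a smooth function whose Bregman distance lies between
the quadratic forms of `G` and `H`. -/
lemma inner_gradient_sub_ge {E : Type*} [NormedAddCommGroup E] [InnerProductSpace ℝ E]
    [CompleteSpace E] (f : E → ℝ) (G H : E →L[ℝ] E) (hG : ∀ u : E, 0 ≤ ⟪u, G u⟫_ℝ)
    (hlow : ∀ x x' : E, (1 / 2) * qf G (x - x') ≤ f x - f x' - ⟪x - x', gradient f x'⟫_ℝ)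
    (hupp : ∀ x x' : E, f x - f x' - ⟪x - x', gradient f x'⟫_ℝ ≤ (1 / 2) * qf H (x - x'))
    (x xt xb : E) :
    (1 / 4) * qf G (xt - x) - (1 / 2) * qf H (xt - x) ≤
      ⟪x - xb, gradient f xt - gradient f xb⟫_ℝ := by
  have h₁ := hlow xb xt
  have h₂ := hlow x xb
  have h₃ := hupp x xt
  have h₄ := qf_sub_le G hG xt x xb
  have h₅ : qf H (x - xt) = qf H (xt - x) := by
    rw [← neg_sub xt x]; simp only [qf, map_neg, inner_neg_neg]
  rw [h₅] at h₃
  simp only [inner_sub_left, inner_sub_right] at h₁ h₂ h₃ ⊢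
  linarith

/-- The subdifferential of a function is a monotone operator. -/
lemma IsSubgrad.monotone {E : Type*} [NormedAddCommGroup E] [InnerProductSpace ℝ E]
    {f : E → ℝ} {v w x y : E} (hx : IsSubgrad f v x) (hy : IsSubgrad f w y) :
    0 ≤ ⟪v - w, x - y⟫_ℝ := by
  have h₁ := hx y
  have h₂ := hy x
  simp only [inner_sub_left, inner_sub_right] at h₁ h₂ ⊢
  linarith

/-- The error estimate for one block of the composite problem, with `P` the proximal operator. -/
lemma block_error_ge {E Z : Type*} [NormedAddCommGroup E] [InnerProductSpace ℝ E]
    [CompleteSpace E] [NormedAddCommGroup Z] [InnerProductSpace ℝ Z]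
    (f g : E → ℝ) (G H P : E →L[ℝ] E) (hG : ∀ u : E, 0 ≤ ⟪u, G u⟫_ℝ)
    (hlow : ∀ x x' : E, (1 / 2) * qf G (x - x') ≤ f x - f x' - ⟪x - x', gradient f x'⟫_ℝ)
    (hupp : ∀ x x' : E, f x - f x' - ⟪x - x', gradient f x'⟫_ℝ ≤ (1 / 2) * qf H (x - x'))
    (A : Z →L[ℝ] E) (As : E →L[ℝ] Z) (hA : ∀ (z : Z) (x : E), ⟪A z, x⟫_ℝ = ⟪z, As x⟫_ℝ)
    (x xt xb : E) (z zb : Z)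
    (hb : IsSubgrad g (-gradient f xb - A zb) xb)
    (hx : IsSubgrad g (-gradient f xt - P (x - xt) - A z) x) :
    (1 / 4) * qf G (xt - x) - (1 / 2) * qf H (xt - x) ≤
      -⟪As (x - xb), z - zb⟫_ℝ + ⟪x - xb, P (xt - x)⟫_ℝ := by
  have h₁ := inner_gradient_sub_ge f G H hG hlow hupp x xt xb
  have h₂ := hx.monotone hb
  have h₃ : -gradient f xt - P (x - xt) - A z - (-gradient f xb - A zb) =
      P (xt - x) - A (z - zb) - (gradient f xt - gradient f xb) := by
    simp only [map_sub]; abel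
  rw [h₃, inner_sub_left, inner_sub_left, hA,
    real_inner_comm (x - xb) (P (xt - x)),
    real_inner_comm (x - xb) (gradient f xt - gradient f xb),
    real_inner_comm (As (x - xb)) (z - zb)] at h₂
  linarith

theorem stmt_9 {X Y Z : Type*}
    [NormedAddCommGroup X] [InnerProductSpace ℝ X] [FiniteDimensional ℝ X]
    [NormedAddCommGroup Y] [InnerProductSpace ℝ Y] [FiniteDimensional ℝ Y]
    [NormedAddCommGroup Z] [InnerProductSpace ℝ Z] [FiniteDimensional ℝ Z]
    (f1 f2 : X → ℝ) (h1 h2 : Y → ℝ)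
    (hf1c : ConvexOn ℝ Set.univ f1) (hf1d : Differentiable ℝ f1)
    (hh1c : ConvexOn ℝ Set.univ h1) (hh1d : Differentiable ℝ h1)
    (hf2c : ConvexOn ℝ Set.univ f2) (hh2c : ConvexOn ℝ Set.univ h2)
    (Sf Sfh : X →L[ℝ] X) (Sh Shh : Y →L[ℝ] Y)
    (hSfsa : ∀ u v : X, ⟪Sf u, v⟫_ℝ = ⟪u, Sf v⟫_ℝ)
    (hSfhsa : ∀ u v : X, ⟪Sfh u, v⟫_ℝ = ⟪u, Sfh v⟫_ℝ)
    (hShsa : ∀ u v : Y, ⟪Sh u, v⟫_ℝ = ⟪u, Sh v⟫_ℝ)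
    (hShhsa : ∀ u v : Y, ⟪Shh u, v⟫_ℝ = ⟪u, Shh v⟫_ℝ)
    (hSfpsd : ∀ u : X, 0 ≤ ⟪u, Sf u⟫_ℝ) (hSfhpsd : ∀ u : X, 0 ≤ ⟪u, Sfh u⟫_ℝ)
    (hShpsd : ∀ u : Y, 0 ≤ ⟪u, Sh u⟫_ℝ) (hShhpsd : ∀ u : Y, 0 ≤ ⟪u, Shh u⟫_ℝ)
    (hfle : ∀ u : X, 0 ≤ ⟪u, (Sfh - Sf) u⟫_ℝ)
    (hhle : ∀ u : Y, 0 ≤ ⟪u, (Shh - Sh) u⟫_ℝ)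
    (hflow : ∀ x x' : X,
      (1 / 2) * qf Sf (x - x') ≤ f1 x - f1 x' - ⟪x - x', gradient f1 x'⟫_ℝ)
    (hfupp : ∀ x x' : X,
      f1 x - f1 x' - ⟪x - x', gradient f1 x'⟫_ℝ ≤ (1 / 2) * qf Sfh (x - x'))
    (hhlow : ∀ y y' : Y,
      (1 / 2) * qf Sh (y - y') ≤ h1 y - h1 y' - ⟪y - y', gradient h1 y'⟫_ℝ)
    (hhupp : ∀ y y' : Y,
      h1 y - h1 y' - ⟪y - y', gradient h1 y'⟫_ℝ ≤ (1 / 2) * qf Shh (y - y'))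
    (A : Z →L[ℝ] X) (As : X →L[ℝ] Z) (B : Z →L[ℝ] Y) (Bs : Y →L[ℝ] Z)
    (hA : ∀ (zz : Z) (xx : X), ⟪A zz, xx⟫_ℝ = ⟪zz, As xx⟫_ℝ)
    (hB : ∀ (zz : Z) (yy : Y), ⟪B zz, yy⟫_ℝ = ⟪zz, Bs yy⟫_ℝ)
    (c : Z) (σ : ℝ) (hσ : 0 < σ)
    (S : X →L[ℝ] X) (T : Y →L[ℝ] Y)
    (hSsa : ∀ u v : X, ⟪S u, v⟫_ℝ = ⟪u, S v⟫_ℝ)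
    (hTsa : ∀ u v : Y, ⟪T u, v⟫_ℝ = ⟪u, T v⟫_ℝ)
    (hSpsd : ∀ u : X, 0 ≤ ⟪u, S u⟫_ℝ) (hTpsd : ∀ u : Y, 0 ≤ ⟪u, T u⟫_ℝ)
    (xb : X) (yb : Y) (zb : Z)
    (hkkt1 : IsSubgrad f2 (-gradient f1 xb - A zb) xb)
    (hkkt2 : IsSubgrad h2 (-gradient h1 yb - B zb) yb)
    (hkkt3 : As xb + Bs yb = c)
    (xk1 xt1 xk : X) (yk ytk : Y) (zk1 zk : Z)
    (hfocx : IsSubgrad f2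
      (-gradient f1 xt1 - (Sfh + S) (xk1 - xt1) - A zk1) xk1)
    (hfocy : IsSubgrad h2
      (-gradient h1 ytk - (Shh + T) (yk - ytk) -
        B (zk + σ • (As xk + Bs yk - c))) yk) :
    -(⟪As (xk1 - xb), zk1 - zb⟫_ℝ +
        ⟪Bs (yk - yb), (zk - zb) + σ • (As xk + Bs yk - c)⟫_ℝ) +
      ⟪xk1 - xb, (Sfh + S) (xt1 - xk1)⟫_ℝ +
      ⟪yk - yb, (Shh + T) (ytk - yk)⟫_ℝ ≥
    (1 / 4) * qf Sf (xt1 - xk1) + (1 / 4) * qf Sh (ytk - yk) -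
      (1 / 2) * qf Sfh (xt1 - xk1) - (1 / 2) * qf Shh (ytk - yk) := by
  have hx := block_error_ge f1 f2 Sf Sfh (Sfh + S) hSfpsd hflow hfupp A As hA
    xk1 xt1 xb zk1 zb hkkt1 hfocx
  have hy := block_error_ge h1 h2 Sh Shh (Shh + T) hShpsd hhlow hhupp B Bs hB
    yk ytk yb (zk + σ • (As xk + Bs yk - c)) zb hkkt2 hfocy
  rw [add_sub_right_comm] at hy
  linarith
end

section
/- Suppose the sequences satisfy, for every k: z^k = z̃^k + σ(A*x^k + B*ỹ^k − c), ỹ^{k+1} = ỹ^k + ρ(y^k − ỹ^k), z̃^{k+1} = z̃^k + ρ(z^k − z̃^k), and suppose A*x̄ + B*ȳ = c. Set η_k := ⟨A*x_e^{k+1}, z_e^{k+1}⟩ + ⟨B*y_e^k, z_e^k + σ(A*x^k + B*y^k − c)⟩. Then for every k, η_k = (1/(2σρ))·(‖z_e^{k+1} + σ(ρ−1)A*x_e^{k+1}‖² − ‖z_e^k + σ(ρ−1)A*x_e^k‖²) + (σ(2−ρ)/2)·(‖A*x^k + B*y^k − c‖² + ‖A*x_e^{k+1}‖² − ‖A*x_e^k‖²).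 -/
open scoped InnerProductSpace

/-- The energy identity for one relaxed step `z' = z + σ(ρ - 1)a + σρb + σa'`. -/
theorem inner_add_inner_eq_of_relaxed_step {Z : Type*} [NormedAddCommGroup Z]
    [InnerProductSpace ℝ Z] {σ ρ : ℝ} (hσ : σ ≠ 0) (hρ : ρ ≠ 0) {a a' b z z' : Z}
    (h : z' = z + (σ * (ρ - 1)) • a + (σ * ρ) • b + σ • a') :
    ⟪a', z'⟫_ℝ + ⟪b, z + σ • (a + b)⟫_ℝ =
      (1 / (2 * σ * ρ)) *
        (‖z' + (σ * (ρ - 1)) • a'‖ ^ 2 - ‖z + (σ * (ρ - 1)) • a‖ ^ 2) +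
      (σ * (2 - ρ) / 2) * (‖a + b‖ ^ 2 + ‖a'‖ ^ 2 - ‖a‖ ^ 2) := by
  subst h
  simp only [← real_inner_self_eq_norm_sq, inner_add_left, inner_add_right,
    real_inner_smul_left, real_inner_smul_right]
  rw [real_inner_comm a a', real_inner_comm a b, real_inner_comm a z,
    real_inner_comm a' b, real_inner_comm a' z, real_inner_comm b z]
  field_simp
  ring

theorem stmt_10 {X Y Z : Type*}
    [NormedAddCommGroup X] [InnerProductSpace ℝ X] [FiniteDimensional ℝ X]
    [NormedAddCommGroup Y] [InnerProductSpace ℝ Y] [FiniteDimensional ℝ Y]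
    [NormedAddCommGroup Z] [InnerProductSpace ℝ Z] [FiniteDimensional ℝ Z]
    (A : Z →L[ℝ] X) (As : X →L[ℝ] Z) (B : Z →L[ℝ] Y) (Bs : Y →L[ℝ] Z)
    (hA : ∀ (zz : Z) (xx : X), ⟪A zz, xx⟫_ℝ = ⟪zz, As xx⟫_ℝ)
    (hB : ∀ (zz : Z) (yy : Y), ⟪B zz, yy⟫_ℝ = ⟪zz, Bs yy⟫_ℝ)
    (c : Z) (σ ρ : ℝ) (hσ : 0 < σ) (hρ : ρ ∈ Set.Ioo (0 : ℝ) 2)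
    (x : ℕ → X) (y : ℕ → Y) (z : ℕ → Z) (yt : ℕ → Y) (zt : ℕ → Z)
    (xb : X) (yb : Y) (zb : Z)
    (hz : ∀ k, z k = zt k + σ • (As (x k) + Bs (yt k) - c))
    (hyt : ∀ k, yt (k + 1) = yt k + ρ • (y k - yt k))
    (hzt : ∀ k, zt (k + 1) = zt k + ρ • (z k - zt k))
    (hfeas : As xb + Bs yb = c) :
    ∀ k, ⟪As (x (k + 1) - xb), z (k + 1) - zb⟫_ℝ +
        ⟪Bs (y k - yb), (z k - zb) + σ • (As (x k) + Bs (y k) - c)⟫_ℝ =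
      (1 / (2 * σ * ρ)) *
        (‖(z (k + 1) - zb) + (σ * (ρ - 1)) • As (x (k + 1) - xb)‖ ^ 2 -
         ‖(z k - zb) + (σ * (ρ - 1)) • As (x k - xb)‖ ^ 2) +
      (σ * (2 - ρ) / 2) *
        (‖As (x k) + Bs (y k) - c‖ ^ 2 + ‖As (x (k + 1) - xb)‖ ^ 2 -
         ‖As (x k - xb)‖ ^ 2) := by
  intro k
  have hres (u : X) (v : Y) : As u + Bs v - c = As (u - xb) + Bs (v - yb) := by
    rw [← hfeas, map_sub, map_sub]
    abel
  have hstep : z (k + 1) - zb = (z k - zb) + (σ * (ρ - 1)) • As (x k - xb) +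
      (σ * ρ) • Bs (y k - yb) + σ • As (x (k + 1) - xb) := by
    have hzk : zt k = z k - σ • (As (x k) + Bs (yt k) - c) := eq_sub_of_add_eq (hz k).symm
    rw [hz (k + 1), hzt k, hyt k, hzk, ← hfeas]
    simp only [map_add, map_sub, map_smul]
    module
  rw [hres]
  exact inner_add_inner_eq_of_relaxed_step hσ.ne' hρ.1.ne' hstep
end

section
/- Let f2 : X → ℝ be convex and suppose −∇f1(x̃^k) − (Σ̂_{f1}+S)(x^k − x̃^k) − A z^k ∈ ∂f2(x^k) and −∇f1(x̃^{k+1}) − (Σ̂_{f1}+S)(x^{k+1} − x̃^{k+1}) − A z^{k+1} ∈ ∂f2(x^{k+1}), with x̃^{k+1} = x̃^k + ρ(x^k − x̃^k). Assume there exists a self-adjoint positive semidefinite operator Γ on X with Σ̂_{f1} − Γ positive semidefinite and ∇f1(x̃^{k+1}) − ∇f1(x̃^k) = Γ(x̃^{k+1} − x̃^k), and assume (1/2)Σ̂_{f1} + S is positive semidefinite. Then ⟨z^{k+1} − z^k, A*(x^k − x^{k+1})⟩ ≥ ((2−ρ)/2)‖x^{k+1} − x^k‖²_{Σ̂_{f1}+S}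 − (ρ/2)‖x̃^k − x^k‖²_{Σ̂_{f1}+S}. -/
open scoped InnerProductSpace

/-- The subdifferential of a function is a monotone relation. -/
lemma IsSubgrad.inner_sub_nonneg {E : Type*} [NormedAddCommGroup E] [InnerProductSpace ℝ E]
    {f : E → ℝ} {v w x y : E} (hv : IsSubgrad f v x) (hw : IsSubgrad f w y) :
    0 ≤ ⟪w - v, y - x⟫_ℝ := by
  have h₁ := hv y
  have h₂ := hw x
  rw [← neg_sub y x, inner_neg_right] at h₂
  rw [inner_sub_left]
  linarith

/-- Polarization bound for a positive semidefinite symmetric operator. -/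
lemma neg_inner_sub_le_four_mul_inner {E : Type*} [NormedAddCommGroup E] [InnerProductSpace ℝ E]
    (G : E →L[ℝ] E) (hsymm : ∀ u v : E, ⟪G u, v⟫_ℝ = ⟪u, G v⟫_ℝ)
    (hpos : ∀ u : E, 0 ≤ ⟪u, G u⟫_ℝ) (d e : E) :
    -⟪d - e, G (d - e)⟫_ℝ ≤ 4 * ⟪d, G e⟫_ℝ := by
  have h := hpos (d + e)
  have hde : ⟪e, G d⟫_ℝ = ⟪d, G e⟫_ℝ := by rw [← hsymm, real_inner_comm]
  simp only [map_add, map_sub, inner_add_left, inner_add_right, inner_sub_left,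
    inner_sub_right] at h ⊢
  linarith

theorem stmt_12 {X Z : Type*}
    [NormedAddCommGroup X] [InnerProductSpace ℝ X] [FiniteDimensional ℝ X]
    [NormedAddCommGroup Z] [InnerProductSpace ℝ Z] [FiniteDimensional ℝ Z]
    (f1 : X → ℝ) (hf1c : ConvexOn ℝ Set.univ f1) (hf1d : Differentiable ℝ f1)
    (f2 : X → ℝ) (hf2c : ConvexOn ℝ Set.univ f2)
    (Sfh : X →L[ℝ] X)
    (hSfhsa : ∀ u v : X, ⟪Sfh u, v⟫_ℝ = ⟪u, Sfh v⟫_ℝ)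
    (hSfhpsd : ∀ u : X, 0 ≤ ⟪u, Sfh u⟫_ℝ)
    (S : X →L[ℝ] X) (hSsa : ∀ u v : X, ⟪S u, v⟫_ℝ = ⟪u, S v⟫_ℝ)
    (A : Z →L[ℝ] X) (As : X →L[ℝ] Z)
    (hA : ∀ (zz : Z) (xx : X), ⟪A zz, xx⟫_ℝ = ⟪zz, As xx⟫_ℝ)
    (ρ : ℝ) (hρ : ρ ∈ Set.Ioo (0 : ℝ) 2)
    (xk xk1 xtk xtk1 : X) (zk zk1 : Z)
    (hfock : IsSubgrad f2
      (-gradient f1 xtk - (Sfh + S) (xk - xtk) - A zk) xk)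
    (hfock1 : IsSubgrad f2
      (-gradient f1 xtk1 - (Sfh + S) (xk1 - xtk1) - A zk1) xk1)
    (hxt : xtk1 = xtk + ρ • (xk - xtk))
    (Γ : X →L[ℝ] X)
    (hΓsa : ∀ u v : X, ⟪Γ u, v⟫_ℝ = ⟪u, Γ v⟫_ℝ)
    (hΓpsd : ∀ u : X, 0 ≤ ⟪u, Γ u⟫_ℝ)
    (hΓle : ∀ u : X, 0 ≤ ⟪u, (Sfh - Γ) u⟫_ℝ)
    (hΓgrad : gradient f1 xtk1 - gradient f1 xtk = Γ (xtk1 - xtk))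
    (hhalf : ∀ u : X, 0 ≤ ⟪u, ((1 / 2 : ℝ) • Sfh + S) u⟫_ℝ) :
    ⟪zk1 - zk, As (xk - xk1)⟫_ℝ ≥
      ((2 - ρ) / 2) * qf (Sfh + S) (xk1 - xk) -
        (ρ / 2) * qf (Sfh + S) (xtk - xk) := by
  obtain ⟨d, hd⟩ : ∃ d, d = xk1 - xk := ⟨_, rfl⟩
  obtain ⟨e, he⟩ : ∃ e, e = xk - xtk := ⟨_, rfl⟩
  have hgrad : gradient f1 xtk1 = gradient f1 xtk + ρ • Γ e := by
    rw [← map_smul, he, ← sub_eq_iff_eq_add', hΓgrad, hxt, add_sub_cancel_left]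
  have hstep : xk1 - xtk1 = d + e - ρ • e := by
    rw [hxt, hd, he]
    abel
  have hmono := hfock.inner_sub_nonneg hfock1
  have hdual : ⟪zk1 - zk, As (xk - xk1)⟫_ℝ = -⟪d, A (zk1 - zk)⟫_ℝ := by
    rw [← hA, ← neg_sub xk1 xk, inner_neg_right, hd, real_inner_comm]
  have hneg : xtk - xk = -e := by rw [he, neg_sub]
  rw [hgrad, hstep, ← hd, ← he, real_inner_comm] at hmono
  rw [hdual, hneg, ← hd]
  have hΓ := neg_inner_sub_le_four_mul_inner Γ hΓsa hΓpsd d e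
  have hle := hΓle (d - e)
  have hpos := hhalf (d - e)
  have hSfh : ⟪e, Sfh d⟫_ℝ = ⟪d, Sfh e⟫_ℝ := by rw [← hSfhsa, real_inner_comm]
  have hS : ⟪e, S d⟫_ℝ = ⟪d, S e⟫_ℝ := by rw [← hSsa, real_inner_comm]
  have key : 0 ≤ ⟪d, Sfh d⟫_ℝ + ⟪d, S d⟫_ℝ + ⟪e, Sfh e⟫_ℝ + ⟪e, S e⟫_ℝ
      - 2 * (⟪d, Sfh e⟫_ℝ + ⟪d, S e⟫_ℝ - ⟪d, Γ e⟫_ℝ) := by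
    simp only [add_apply, sub_apply,
      smul_apply, map_sub, inner_add_right, inner_sub_left,
      inner_sub_right, real_inner_smul_right] at hΓ hle hpos
    linarith
  have hscaled := mul_nonneg hρ.1.le key
  simp only [qf, add_apply, map_add, map_sub, map_smul, map_neg,
    inner_add_right, inner_sub_right, inner_neg_left, inner_neg_right,
    real_inner_smul_right] at hmono ⊢
  linarith
end

section
/- Let the G-ADMM-M iterates be given and suppose: a KKT point exists; (1/2)Σ̂_{f1} + S is positive semidefinite; for each k there exists a self-adjoint positive semidefinite operator Γ^k with Σ̂_{f1} − Γ^k positive semidefinite and ∇f1(x̃^{k+1}) − ∇f1(x̃^k) = Γ^k(x̃^{k+1} − x̃^k); the operators Σ̂_{h1} + T, Σ̂_{f1} + S + σAA*, and Σ̂_{h1} + T + σBB* are positive definite; and the series Σ_{k≥1} ξ_k converges, where ξ_k := ‖x̃^{k+1} − x^{k+1}‖²_{Σ̂_{f1}} + ‖ỹ^k − y^k‖²_{Σ̂_{h1}}. Then there exists a KKT point (x*, y*, z*) such that (x^k, y^k, z^k) converges to (x*, y*, z*) as k → ∞. -/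
open scoped InnerProductSpace

open Filter Topology

section QuadraticForms

variable {E : Type*} [NormedAddCommGroup E] [InnerProductSpace ℝ E]

lemma qf_add_le (G : E →L[ℝ] E) (hG : ∀ u, 0 ≤ qf G u) (u v : E) :
    qf G (u + v) ≤ 2 * qf G u + 2 * qf G v := by
  have h := hG (u - v)
  simp only [qf, map_add, map_sub, inner_add_left, inner_add_right, inner_sub_left,
    inner_sub_right] at h ⊢
  linarith

lemma qf_sub_comm (G : E →L[ℝ] E) (u v : E) : qf G (u - v) = qf G (v - u) := by
  rw [← neg_sub v u]
  simp only [qf, map_neg, inner_neg_neg]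

lemma qf_relax (G : E →L[ℝ] E) (hsa : ∀ u v : E, ⟪G u, v⟫_ℝ = ⟪u, G v⟫_ℝ) (ρ : ℝ) (u d : E) :
    qf G (u + ρ • d) = qf G u + 2 * ρ * ⟪G d, u + d⟫_ℝ - ρ * (2 - ρ) * qf G d := by
  have h1 : ⟪G d, u⟫_ℝ = ⟪u, G d⟫_ℝ := real_inner_comm _ _
  have h2 : ⟪G d, d⟫_ℝ = ⟪d, G d⟫_ℝ := real_inner_comm _ _
  have h3 : ⟪d, G u⟫_ℝ = ⟪u, G d⟫_ℝ := by rw [← hsa, h1]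
  simp only [qf, map_add, map_smul, inner_add_left, inner_add_right, real_inner_smul_left,
    real_inner_smul_right, h1, h2, h3]
  ring

lemma norm_sq_relax (ρ : ℝ) (u d : E) :
    ‖u + ρ • d‖ ^ 2 = ‖u‖ ^ 2 + 2 * ρ * ⟪d, u + d⟫_ℝ - ρ * (2 - ρ) * ‖d‖ ^ 2 := by
  have h := qf_relax (ContinuousLinearMap.id ℝ E) (fun _ _ => rfl) ρ u d
  simpa only [qf, ContinuousLinearMap.id_apply, real_inner_self_eq_norm_sq] using h

lemma norm_sq_add_le (u v : E) : ‖u + v‖ ^ 2 ≤ 2 * ‖u‖ ^ 2 + 2 * ‖v‖ ^ 2 := by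
  have h := parallelogram_law_with_norm ℝ u v
  nlinarith [sq_nonneg ‖u - v‖]

/-- A positive definite operator on a finite-dimensional space is coercive. -/
lemma exists_coercive [FiniteDimensional ℝ E] (G : E →L[ℝ] E)
    (hG : ∀ u : E, u ≠ 0 → 0 < ⟪u, G u⟫_ℝ) : ∃ m : ℝ, 0 < m ∧ ∀ u, m * ‖u‖ ^ 2 ≤ qf G u := by
  rcases subsingleton_or_nontrivial E with hE | hE
  · refine ⟨1, one_pos, fun u => ?_⟩
    simp [Subsingleton.elim u 0, qf]
  obtain ⟨v, hv, hmin⟩ := (isCompact_sphere (0 : E) 1).exists_isMinOn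
    (NormedSpace.sphere_nonempty.2 zero_le_one)
    (f := qf G) (by unfold qf; fun_prop)
  have hv1 : ‖v‖ = 1 := by simpa using hv
  refine ⟨qf G v, hG v (by rintro rfl; simp at hv1), fun u => ?_⟩
  by_cases hu : u = 0
  · simp [hu, qf]
  have hu' : 0 < ‖u‖ := norm_pos_iff.2 hu
  have h : qf G v ≤ qf G (‖u‖⁻¹ • u) := hmin (by simp [norm_smul, hu'.ne'])
  have e : qf G (‖u‖⁻¹ • u) = qf G u / ‖u‖ ^ 2 := by
    simp only [qf, map_smul, real_inner_smul_left, real_inner_smul_right]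
    field_simp
  rw [e, le_div_iff₀ (by positivity)] at h
  exact h

lemma norm_sq_apply_le (G : E →L[ℝ] E) (hsa : ∀ u v : E, ⟪G u, v⟫_ℝ = ⟪u, G v⟫_ℝ)
    (hG : ∀ u, 0 ≤ qf G u) (u : E) : ‖G u‖ ^ 2 ≤ (‖G‖ + 1) * qf G u := by
  have h := hG ((‖G‖ + 1) • u - G u)
  have h1 : ⟪u, G (G u)⟫_ℝ = ‖G u‖ ^ 2 := by rw [← hsa, real_inner_self_eq_norm_sq]
  have h2 : ⟪G u, G (G u)⟫_ℝ ≤ ‖G‖ * ‖G u‖ ^ 2 := by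
    refine (real_inner_le_norm _ _).trans ?_
    nlinarith [G.le_opNorm (G u), norm_nonneg (G u)]
  simp only [qf, map_sub, map_smul, inner_sub_left, inner_sub_right, real_inner_smul_left,
    real_inner_smul_right, h1, real_inner_self_eq_norm_sq] at h ⊢
  have h3 : (‖G‖ + 1) * ‖G u‖ ^ 2 ≤ (‖G‖ + 1) * ((‖G‖ + 1) * ⟪u, G u⟫_ℝ) := by
    nlinarith [sq_nonneg ‖G u‖]
  exact le_of_mul_le_mul_left h3 (by positivity)

lemma tendsto_apply_of_qf {ι : Type*} {l : Filter ι} (G : E →L[ℝ] E)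
    (hsa : ∀ u v : E, ⟪G u, v⟫_ℝ = ⟪u, G v⟫_ℝ) (hG : ∀ u, 0 ≤ qf G u) {u : ι → E}
    (hu : Tendsto (fun k => qf G (u k)) l (𝓝 0)) : Tendsto (fun k => G (u k)) l (𝓝 0) := by
  have h : Tendsto (fun k => ‖G (u k)‖ ^ 2) l (𝓝 0) :=
    squeeze_zero (fun _ => sq_nonneg _) (fun k => norm_sq_apply_le G hsa hG (u k))
      (by simpa using hu.const_mul (‖G‖ + 1))
  exact tendsto_zero_iff_norm_tendsto_zero.2
    (by simpa [Real.sqrt_sq] using h.sqrt)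

end QuadraticForms

lemma tendsto_of_norm_sub_sq_le {E ι : Type*} [SeminormedAddCommGroup E] {l : Filter ι}
    {u : ι → E} {a : E} {q : ι → ℝ} (hq : ∀ k, ‖u k - a‖ ^ 2 ≤ q k) (h : Tendsto q l (𝓝 0)) :
    Tendsto u l (𝓝 a) := by
  have h1 := squeeze_zero (fun _ => sq_nonneg _) hq h
  exact tendsto_iff_norm_sub_tendsto_zero.2 (by simpa [Real.sqrt_sq] using h1.sqrt)

/-- A nonnegative sequence that decreases up to summable errors converges, and its decrements
tend to zero. -/
lemma tendsto_of_decrease_le_summable {V D ε : ℕ → ℝ} (hV : ∀ k, 0 ≤ V k) (hD : ∀ k, 0 ≤ D k)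
    (hε : ∀ k, 0 ≤ ε k) (hsum : Summable ε) (h : ∀ k, V (k + 1) + D k ≤ V k + ε k) :
    (∃ l, Tendsto V atTop (𝓝 l)) ∧ Tendsto D atTop (𝓝 0) := by
  have hanti : Antitone fun k => V k - ∑ i ∈ Finset.range k, ε i :=
    antitone_nat_of_succ_le fun k => by
      rw [Finset.sum_range_succ]
      linarith [h k, hD k]
  have hbdd : BddBelow (Set.range fun k => V k - ∑ i ∈ Finset.range k, ε i) := by
    refine ⟨-∑' i, ε i, ?_⟩
    rintro _ ⟨k, rfl⟩
    have := hsum.sum_le_tsum (Finset.range k) fun i _ => hε i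
    simp only
    linarith [hV k]
  have hlim : ∃ l, Tendsto V atTop (𝓝 l) :=
    ⟨_, by simpa using (tendsto_atTop_ciInf hanti hbdd).add hsum.hasSum.tendsto_sum_nat⟩
  refine ⟨hlim, ?_⟩
  obtain ⟨l, hl⟩ := hlim
  have h0 : Tendsto (fun k => V k - V (k + 1) + ε k) atTop (𝓝 0) := by
    simpa using (hl.sub (hl.comp (tendsto_add_atTop_nat 1))).add hsum.tendsto_atTop_zero
  exact squeeze_zero hD (fun k => by linarith [h k]) h0

section CompositeOptimality

variable {E : Type*} [NormedAddCommGroup E] [InnerProductSpace ℝ E]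

lemma inner_subgrad_sub_nonneg {f : E → ℝ} {v w x y : E} (hv : IsSubgrad f v x)
    (hw : IsSubgrad f w y) : 0 ≤ ⟪v - w, x - y⟫_ℝ := by
  have h1 := hv y
  have h2 := hw x
  rw [← neg_sub x y, inner_neg_right] at h1
  rw [inner_sub_left]
  linarith

/-- The basic estimate for a majorized proximal step on `f + g` compared with a stationary
point `xb`. -/
lemma inner_prox_step_le [CompleteSpace E] {f g : E → ℝ} {L F : E →L[ℝ] E}
    (hlow : ∀ x x' : E, 0 ≤ f x - f x' - ⟪x - x', gradient f x'⟫_ℝ)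
    (hupp : ∀ x x' : E, f x - f x' - ⟪x - x', gradient f x'⟫_ℝ ≤ (1 / 2) * qf L (x - x'))
    {x xt xb p pb : E} (hx : IsSubgrad g (-gradient f xt - F (x - xt) - p) x)
    (hxb : IsSubgrad g (-gradient f xb - pb) xb) :
    ⟪F (x - xt), x - xb⟫_ℝ + ⟪p - pb, x - xb⟫_ℝ ≤ (1 / 2) * qf L (x - xt) := by
  have h0 := inner_subgrad_sub_nonneg hx hxb
  have h1 := hupp x xt
  have h2 := hlow x xb
  have h3 := hlow xb xt
  have e : -gradient f xt - F (x - xt) - p - (-gradient f xb - pb)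
      = gradient f xb - gradient f xt - F (x - xt) - (p - pb) := by abel
  have e2 : xb - xt = (x - xt) - (x - xb) := by abel
  rw [e, inner_sub_left, inner_sub_left, inner_sub_left] at h0
  rw [e2, inner_sub_left, real_inner_comm _ (x - xb)] at h3
  rw [real_inner_comm] at h2
  linarith

/-- Subtracting the gradient of a smooth summand from a subgradient of a sum. -/
lemma isSubgrad_of_add [CompleteSpace E] {f g : E → ℝ} {L : E →L[ℝ] E}
    (hupp : ∀ x x' : E, f x - f x' - ⟪x - x', gradient f x'⟫_ℝ ≤ (1 / 2) * qf L (x - x'))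
    (hg : ConvexOn ℝ Set.univ g) {x v : E} (h : IsSubgrad (fun w => f w + g w) v x) :
    IsSubgrad g (-gradient f x + v) x := by
  intro w
  set d := w - x with hd
  have key : ∀ t ∈ Set.Ioo (0 : ℝ) 1,
      g x + ⟪-gradient f x + v, d⟫_ℝ - t * ((1 / 2) * qf L d) ≤ g w := by
    rintro t ⟨ht0, ht1⟩
    have h1 := h (x + t • d)
    have h2 := hupp (x + t • d) x
    have h3 : g (x + t • d) ≤ (1 - t) * g x + t * g w := by
      have := hg.2 (Set.mem_univ x) (Set.mem_univ w) (sub_nonneg.2 ht1.le) ht0.le (by ring)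
      have e : x + t • d = (1 - t) • x + t • w := by rw [hd]; module
      rw [e]
      exact this
    simp only [add_sub_cancel_left, real_inner_smul_left, real_inner_smul_right, qf,
      map_smul] at h1 h2
    rw [real_inner_comm] at h2
    rw [inner_add_left, inner_neg_left]
    refine le_of_mul_le_mul_left ?_ ht0
    unfold qf
    nlinarith
  have hlim : Tendsto (fun t : ℝ => g x + ⟪-gradient f x + v, d⟫_ℝ - t * ((1 / 2) * qf L d))
      (𝓝[>] 0) (𝓝 (g x + ⟪-gradient f x + v, d⟫_ℝ - 0 * ((1 / 2) * qf L d))) :=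
    ((by fun_prop : Continuous fun t : ℝ =>
      g x + ⟪-gradient f x + v, d⟫_ℝ - t * ((1 / 2) * qf L d)).tendsto 0).mono_left
        nhdsWithin_le_nhds
  have := le_of_tendsto hlim
    (Filter.mem_of_superset (Ioo_mem_nhdsGT one_pos) fun t ht => key t ht)
  simpa using this

/-- Limits of majorized proximal steps with vanishing displacement are stationary. -/
lemma isSubgrad_of_tendsto_prox_steps [FiniteDimensional ℝ E] {f g : E → ℝ} {L F : E →L[ℝ] E}
    (hf : Continuous f) (hg : ConvexOn ℝ Set.univ g)
    (hlow : ∀ x x' : E, 0 ≤ f x - f x' - ⟪x - x', gradient f x'⟫_ℝ)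
    (hupp : ∀ x x' : E, f x - f x' - ⟪x - x', gradient f x'⟫_ℝ ≤ (1 / 2) * qf L (x - x'))
    {x xt p : ℕ → E} {xs ps : E}
    (hstep : ∀ k, IsSubgrad g (-gradient f (xt k) - F (x k - xt k) - p k) (x k))
    (hx : Tendsto x atTop (𝓝 xs)) (hp : Tendsto p atTop (𝓝 ps))
    (hF : Tendsto (fun k => F (x k - xt k)) atTop (𝓝 0))
    (hL : Tendsto (fun k => qf L (x k - xt k)) atTop (𝓝 0)) :
    IsSubgrad g (-gradient f xs - ps) xs := by
  have hgc : Continuous g := continuousOn_univ.1 (hg.continuousOn isOpen_univ)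
  rw [sub_eq_add_neg]
  refine isSubgrad_of_add hupp hg fun w => ?_
  have hlim : Tendsto (fun k => (f (x k) + g (x k)) - (1 / 2) * qf L (x k - xt k)
      + ⟪-F (x k - xt k) - p k, w - x k⟫_ℝ) atTop
      (𝓝 (f xs + g xs - (1 / 2) * 0 + ⟪-0 - ps, w - xs⟫_ℝ)) :=
    ((((hf.tendsto _).comp hx).add ((hgc.tendsto _).comp hx)).sub (hL.const_mul _)).add
      ((hF.neg.sub hp).inner (tendsto_const_nhds.sub hx))
  have := le_of_tendsto' hlim (b := f w + g w) fun k => by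
    have h1 := hstep k w
    have h2 := hupp (x k) (xt k)
    have h3 := hlow w (xt k)
    rw [sub_sub, sub_eq_add_neg, inner_add_left, inner_neg_left] at h1
    have e : -F (x k - xt k) - p k = -(F (x k - xt k) + p k) := by abel
    have e2 : w - xt k = (w - x k) + (x k - xt k) := by abel
    rw [e2, inner_add_left, real_inner_comm _ (w - x k)] at h3
    rw [e]
    linarith
  simpa using this

end CompositeOptimality

section Energy

variable {X Y Z : Type*} [NormedAddCommGroup X] [InnerProductSpace ℝ X]
  [NormedAddCommGroup Y] [InnerProductSpace ℝ Y] [NormedAddCommGroup Z] [InnerProductSpace ℝ Z]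

/-- The Lyapunov function of the generalized ADMM, seen as a degenerate proximal point method. -/
noncomputable def energy (F : X →L[ℝ] X) (H : Y →L[ℝ] Y) (Bs : Y →L[ℝ] Z) (σ : ℝ)
    (x : X) (y : Y) (z : Z) : ℝ :=
  qf F x + qf H y + σ⁻¹ * ‖z + σ • Bs y‖ ^ 2

variable {F : X →L[ℝ] X} {H : Y →L[ℝ] Y} {Bs : Y →L[ℝ] Z} {σ : ℝ}

lemma energy_nonneg (hF : ∀ u, 0 ≤ qf F u) (hH : ∀ u, 0 ≤ qf H u) (hσ : 0 < σ)
    (x : X) (y : Y) (z : Z) : 0 ≤ energy F H Bs σ x y z := by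
  have := hF x
  have := hH y
  unfold energy
  positivity

lemma energy_add_le (hF : ∀ u, 0 ≤ qf F u) (hH : ∀ u, 0 ≤ qf H u) (hσ : 0 < σ)
    (x x' : X) (y y' : Y) (z z' : Z) :
    energy F H Bs σ (x + x') (y + y') (z + z')
      ≤ 2 * energy F H Bs σ x y z + 2 * energy F H Bs σ x' y' z' := by
  have h1 := qf_add_le F hF x x'
  have h2 := qf_add_le H hH y y'
  have h3 := mul_le_mul_of_nonneg_left (norm_sq_add_le (z + σ • Bs y) (z' + σ • Bs y'))
    (inv_pos.2 hσ).le
  have e : z + z' + σ • Bs (y + y') = (z + σ • Bs y) + (z' + σ • Bs y') := by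
    rw [map_add]; module
  unfold energy
  rw [e]
  linarith

lemma energy_neg (x : X) (y : Y) (z : Z) :
    energy F H Bs σ (-x) (-y) (-z) = energy F H Bs σ x y z := by
  have e : -z + σ • Bs (-y) = -(z + σ • Bs y) := by rw [map_neg]; module
  unfold energy
  rw [e, norm_neg]
  simp only [qf, map_neg, inner_neg_neg]

lemma energy_relax (hF : ∀ u v : X, ⟪F u, v⟫_ℝ = ⟪u, F v⟫_ℝ)
    (hH : ∀ u v : Y, ⟪H u, v⟫_ℝ = ⟪u, H v⟫_ℝ) (ρ : ℝ) (x dx : X) (y dy : Y) (z dz : Z) :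
    energy F H Bs σ (x + ρ • dx) (y + ρ • dy) (z + ρ • dz)
      = energy F H Bs σ x y z
        + 2 * ρ * (⟪F dx, x + dx⟫_ℝ + ⟪H dy, y + dy⟫_ℝ
          + σ⁻¹ * ⟪dz + σ • Bs dy, (z + dz) + σ • Bs (y + dy)⟫_ℝ)
        - ρ * (2 - ρ) * energy F H Bs σ dx dy dz := by
  have e : z + ρ • dz + σ • Bs (y + ρ • dy) = (z + σ • Bs y) + ρ • (dz + σ • Bs dy) := by
    rw [map_add, map_smul]; module
  have e2 : (z + dz) + σ • Bs (y + dy) = (z + σ • Bs y) + (dz + σ • Bs dy) := by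
    rw [map_add]; module
  unfold energy
  rw [e, e2, qf_relax F hF, qf_relax H hH, norm_sq_relax]
  ring

lemma continuous_energy :
    Continuous fun w : X × Y × Z => energy F H Bs σ w.1 w.2.1 w.2.2 := by
  unfold energy qf
  fun_prop

/-- One step of the relaxed iteration decreases the energy of the errors `xe - dx`, `ye - dy`,
`ze - dz` up to the majorization errors `α` and `β`. -/
lemma energy_step_le {A : Z →L[ℝ] X} {As : X →L[ℝ] Z} {B : Z →L[ℝ] Y} (hσ : 0 < σ)
    (hF : ∀ u v : X, ⟪F u, v⟫_ℝ = ⟪u, F v⟫_ℝ) (hH : ∀ u v : Y, ⟪H u, v⟫_ℝ = ⟪u, H v⟫_ℝ)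
    (hA : ∀ (zz : Z) (xx : X), ⟪A zz, xx⟫_ℝ = ⟪zz, As xx⟫_ℝ)
    (hB : ∀ (zz : Z) (yy : Y), ⟪B zz, yy⟫_ℝ = ⟪zz, Bs yy⟫_ℝ)
    {ρ α β : ℝ} (hρ : 0 ≤ ρ) {xe dx : X} {ye dy : Y} {ze dz : Z}
    (hdz : dz + σ • Bs dy = σ • (As xe + Bs ye))
    (hx : ⟪F dx, xe⟫_ℝ + ⟪A ze, xe⟫_ℝ ≤ (1 / 2) * α)
    (hy : ⟪H dy, ye⟫_ℝ + ⟪B (ze + σ • (As xe + Bs ye)), ye⟫_ℝ ≤ (1 / 2) * β) :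
    energy F H Bs σ (xe - dx + ρ • dx) (ye - dy + ρ • dy) (ze - dz + ρ • dz)
        + ρ * (2 - ρ) * energy F H Bs σ dx dy dz
      ≤ energy F H Bs σ (xe - dx) (ye - dy) (ze - dz) + ρ * (α + β) := by
  simp only [energy_relax hF hH, sub_add_cancel, hdz,
    real_inner_smul_left _ _ σ, inv_mul_cancel_left₀ hσ.ne']
  rw [hA] at hx
  rw [hB] at hy
  have h : ⟪ze, As xe⟫_ℝ + ⟪ze + σ • (As xe + Bs ye), Bs ye⟫_ℝ
      = ⟪As xe + Bs ye, ze + σ • Bs ye⟫_ℝ := by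
    simp only [inner_add_left, inner_add_right, real_inner_smul_left, real_inner_smul_right,
      real_inner_comm ze]
    ring
  have := mul_le_mul_of_nonneg_left (add_le_add hx hy) hρ
  rw [← h]
  linarith

/-- Together with the residual of the linear constraint, the energy controls the norm. -/
lemma exists_norm_sq_le_energy {A : Z →L[ℝ] X} {As : X →L[ℝ] Z} (hσ : 0 < σ)
    [FiniteDimensional ℝ X] [FiniteDimensional ℝ Y]
    (hA : ∀ (zz : Z) (xx : X), ⟪A zz, xx⟫_ℝ = ⟪zz, As xx⟫_ℝ)
    (hF : ∀ u, 0 ≤ qf F u) (hH : ∀ u : Y, u ≠ 0 → 0 < ⟪u, H u⟫_ℝ)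
    (hFA : ∀ u : X, u ≠ 0 → 0 < ⟪u, (F + σ • (A.comp As)) u⟫_ℝ) :
    ∃ C : ℝ, ∀ x y z, ‖x‖ ^ 2 + ‖y‖ ^ 2 + ‖z‖ ^ 2
      ≤ C * (energy F H Bs σ x y z + ‖As x + Bs y‖ ^ 2) := by
  obtain ⟨a, ha, hxa⟩ := exists_coercive _ hFA
  obtain ⟨b, hb, hyb⟩ := exists_coercive _ hH
  set β := ‖Bs‖ ^ 2
  refine ⟨a⁻¹ * (1 + 2 * σ + 2 * σ * β * b⁻¹) + b⁻¹ + (2 * σ + 2 * σ ^ 2 * β * b⁻¹),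
    fun x y z => ?_⟩
  set N := energy F H Bs σ x y z + ‖As x + Bs y‖ ^ 2 with hN
  have hB : ‖Bs y‖ ^ 2 ≤ β * ‖y‖ ^ 2 := by
    rw [← mul_pow]
    exact pow_le_pow_left₀ (norm_nonneg _) (Bs.le_opNorm y) 2
  have hβ : 0 ≤ β := sq_nonneg _
  have hFx := hF x
  have hy0 : 0 ≤ qf H y := le_trans (by positivity) (hyb y)
  have hz0 : 0 ≤ σ⁻¹ * ‖z + σ • Bs y‖ ^ 2 := by positivity
  have hr0 : 0 ≤ ‖As x + Bs y‖ ^ 2 := by positivity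
  unfold energy at hN
  have hy : ‖y‖ ^ 2 ≤ b⁻¹ * N := by
    rw [inv_mul_eq_div, le_div_iff₀' hb]
    linarith [hyb y]
  have hBN : ‖Bs y‖ ^ 2 ≤ β * (b⁻¹ * N) := hB.trans (mul_le_mul_of_nonneg_left hy hβ)
  have hz : ‖z‖ ^ 2 ≤ (2 * σ + 2 * σ ^ 2 * β * b⁻¹) * N := by
    have h1 := norm_sq_add_le (z + σ • Bs y) (-(σ • Bs y))
    rw [add_neg_cancel_right, norm_neg, norm_smul, mul_pow, Real.norm_eq_abs, sq_abs] at h1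
    have h2 : ‖z + σ • Bs y‖ ^ 2 ≤ σ * N := by
      rw [← inv_mul_le_iff₀ hσ]
      linarith
    have h3 := mul_le_mul_of_nonneg_left hBN (sq_nonneg σ)
    linarith
  have hx : ‖x‖ ^ 2 ≤ a⁻¹ * ((1 + 2 * σ + 2 * σ * β * b⁻¹) * N) := by
    rw [inv_mul_eq_div, le_div_iff₀' ha]
    have h1 := norm_sq_add_le (As x + Bs y) (-(Bs y))
    rw [add_neg_cancel_right, norm_neg] at h1
    have h2 : qf (F + σ • (A.comp As)) x = qf F x + σ * ‖As x‖ ^ 2 := by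
      simp only [qf, add_apply, smul_apply,
        ContinuousLinearMap.comp_apply, inner_add_right, real_inner_smul_right]
      rw [real_inner_comm (A (As x)), hA, real_inner_self_eq_norm_sq]
    have h3 := hxa x
    rw [h2] at h3
    have h4 : ‖As x‖ ^ 2 ≤ 2 * N + 2 * (β * (b⁻¹ * N)) := by linarith
    have h5 := mul_le_mul_of_nonneg_left h4 hσ.le
    linarith
  linarith

end Energy

theorem stmt_16 {X Y Z : Type*}
    [NormedAddCommGroup X] [InnerProductSpace ℝ X] [FiniteDimensional ℝ X]
    [NormedAddCommGroup Y] [InnerProductSpace ℝ Y] [FiniteDimensional ℝ Y]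
    [NormedAddCommGroup Z] [InnerProductSpace ℝ Z] [FiniteDimensional ℝ Z]
    (f1 f2 : X → ℝ) (h1 h2 : Y → ℝ)
    (hf1c : ConvexOn ℝ Set.univ f1) (hf1d : Differentiable ℝ f1)
    (hh1c : ConvexOn ℝ Set.univ h1) (hh1d : Differentiable ℝ h1)
    (hf2c : ConvexOn ℝ Set.univ f2) (hh2c : ConvexOn ℝ Set.univ h2)
    (Sf Sfh : X →L[ℝ] X) (Sh Shh : Y →L[ℝ] Y)
    (hSfsa : ∀ u v : X, ⟪Sf u, v⟫_ℝ = ⟪u, Sf v⟫_ℝ)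
    (hSfhsa : ∀ u v : X, ⟪Sfh u, v⟫_ℝ = ⟪u, Sfh v⟫_ℝ)
    (hShsa : ∀ u v : Y, ⟪Sh u, v⟫_ℝ = ⟪u, Sh v⟫_ℝ)
    (hShhsa : ∀ u v : Y, ⟪Shh u, v⟫_ℝ = ⟪u, Shh v⟫_ℝ)
    (hSfpsd : ∀ u : X, 0 ≤ ⟪u, Sf u⟫_ℝ) (hSfhpsd : ∀ u : X, 0 ≤ ⟪u, Sfh u⟫_ℝ)
    (hShpsd : ∀ u : Y, 0 ≤ ⟪u, Sh u⟫_ℝ) (hShhpsd : ∀ u : Y, 0 ≤ ⟪u, Shh u⟫_ℝ)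
    (hfle : ∀ u : X, 0 ≤ ⟪u, (Sfh - Sf) u⟫_ℝ)
    (hhle : ∀ u : Y, 0 ≤ ⟪u, (Shh - Sh) u⟫_ℝ)
    (hflow : ∀ x x' : X,
      (1 / 2) * qf Sf (x - x') ≤ f1 x - f1 x' - ⟪x - x', gradient f1 x'⟫_ℝ)
    (hfupp : ∀ x x' : X,
      f1 x - f1 x' - ⟪x - x', gradient f1 x'⟫_ℝ ≤ (1 / 2) * qf Sfh (x - x'))
    (hhlow : ∀ y y' : Y,
      (1 / 2) * qf Sh (y - y') ≤ h1 y - h1 y' - ⟪y - y', gradient h1 y'⟫_ℝ)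
    (hhupp : ∀ y y' : Y,
      h1 y - h1 y' - ⟪y - y', gradient h1 y'⟫_ℝ ≤ (1 / 2) * qf Shh (y - y'))
    (A : Z →L[ℝ] X) (As : X →L[ℝ] Z) (B : Z →L[ℝ] Y) (Bs : Y →L[ℝ] Z)
    (hA : ∀ (zz : Z) (xx : X), ⟪A zz, xx⟫_ℝ = ⟪zz, As xx⟫_ℝ)
    (hB : ∀ (zz : Z) (yy : Y), ⟪B zz, yy⟫_ℝ = ⟪zz, Bs yy⟫_ℝ)
    (c : Z) (σ ρ : ℝ) (hσ : 0 < σ) (hρ : ρ ∈ Set.Ioo (0 : ℝ) 2)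
    (S : X →L[ℝ] X) (T : Y →L[ℝ] Y)
    (hSsa : ∀ u v : X, ⟪S u, v⟫_ℝ = ⟪u, S v⟫_ℝ)
    (hTsa : ∀ u v : Y, ⟪T u, v⟫_ℝ = ⟪u, T v⟫_ℝ)
    (hSpsd : ∀ u : X, 0 ≤ ⟪u, S u⟫_ℝ) (hTpsd : ∀ u : Y, 0 ≤ ⟪u, T u⟫_ℝ)
    (x xt : ℕ → X) (y yt : ℕ → Y) (z zt : ℕ → Z)
    (hfocx : ∀ k, IsSubgrad f2
      (-gradient f1 (xt k) - (Sfh + S) (x k - xt k) - A (z k)) (x k))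
    (hzdef : ∀ k, z k = zt k + σ • (As (x k) + Bs (yt k) - c))
    (hfocy : ∀ k, IsSubgrad h2
      (-gradient h1 (yt k) - (Shh + T) (y k - yt k) -
        B (z k + σ • (As (x k) + Bs (y k) - c))) (y k))
    (hxt : ∀ k, xt (k + 1) = xt k + ρ • (x k - xt k))
    (hyt : ∀ k, yt (k + 1) = yt k + ρ • (y k - yt k))
    (hzt : ∀ k, zt (k + 1) = zt k + ρ • (z k - zt k))
    (hkkt : ∃ (xb : X) (yb : Y) (zb : Z),
      IsSubgrad f2 (-gradient f1 xb - A zb) xb ∧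
      IsSubgrad h2 (-gradient h1 yb - B zb) yb ∧ As xb + Bs yb = c)
    (hhalf : ∀ u : X, 0 ≤ ⟪u, ((1 / 2 : ℝ) • Sfh + S) u⟫_ℝ)
    (Γ : ℕ → X →L[ℝ] X)
    (hΓsa : ∀ k, ∀ u v : X, ⟪Γ k u, v⟫_ℝ = ⟪u, Γ k v⟫_ℝ)
    (hΓpsd : ∀ k, ∀ u : X, 0 ≤ ⟪u, Γ k u⟫_ℝ)
    (hΓle : ∀ k, ∀ u : X, 0 ≤ ⟪u, (Sfh - Γ k) u⟫_ℝ)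
    (hΓgrad : ∀ k,
      gradient f1 (xt (k + 1)) - gradient f1 (xt k) = Γ k (xt (k + 1) - xt k))
    (hTpd : ∀ u : Y, u ≠ 0 → 0 < ⟪u, (Shh + T) u⟫_ℝ)
    (hFpd : ∀ u : X, u ≠ 0 → 0 < ⟪u, (Sfh + S + σ • (A.comp As)) u⟫_ℝ)
    (hHpd : ∀ u : Y, u ≠ 0 → 0 < ⟪u, (Shh + T + σ • (B.comp Bs)) u⟫_ℝ)
    (hxi : Summable (fun k : ℕ =>
      qf Sfh (xt (k + 2) - x (k + 2)) + qf Shh (yt (k + 1) - y (k + 1)))) :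
    ∃ (xs : X) (ys : Y) (zs : Z),
      (IsSubgrad f2 (-gradient f1 xs - A zs) xs ∧
        IsSubgrad h2 (-gradient h1 ys - B zs) ys ∧ As xs + Bs ys = c) ∧
      Filter.Tendsto (fun k => (x k, y k, z k)) Filter.atTop
        (nhds (xs, ys, zs)) := by
  obtain ⟨hρ0, hρ2⟩ := hρ
  have hρρ : 0 < ρ * (2 - ρ) := mul_pos hρ0 (by linarith)
  set F := Sfh + S with hFdef
  set H := Shh + T with hHdef
  have hFsa : ∀ u v : X, ⟪F u, v⟫_ℝ = ⟪u, F v⟫_ℝ := fun u v => by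
    simp [hFdef, inner_add_left, inner_add_right, hSfhsa, hSsa]
  have hHsa : ∀ u v : Y, ⟪H u, v⟫_ℝ = ⟪u, H v⟫_ℝ := fun u v => by
    simp [hHdef, inner_add_left, inner_add_right, hShhsa, hTsa]
  have hF0 : ∀ u, 0 ≤ qf F u := fun u => by
    simpa [hFdef, qf, inner_add_right] using add_nonneg (hSfhpsd u) (hSpsd u)
  have hH0 : ∀ u, 0 ≤ qf H u := fun u => by
    simpa [hHdef, qf, inner_add_right] using add_nonneg (hShhpsd u) (hTpsd u)
  have hf0 : ∀ u v : X, 0 ≤ f1 u - f1 v - ⟪u - v, gradient f1 v⟫_ℝ := fun u v =>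
    (mul_nonneg (by norm_num) (hSfpsd (u - v))).trans (hflow u v)
  have hh0 : ∀ u v : Y, 0 ≤ h1 u - h1 v - ⟪u - v, gradient h1 v⟫_ℝ := fun u v =>
    (mul_nonneg (by norm_num) (hShpsd (u - v))).trans (hhlow u v)
  -- The residual, the squared step length, and the summable majorization errors.
  set r : ℕ → Z := fun k => As (x k) + Bs (y k) - c with hr
  set D : ℕ → ℝ := fun k => energy F H Bs σ (x k - xt k) (y k - yt k) (z k - zt k) with hD
  have hD0 : ∀ k, 0 ≤ D k := fun k => energy_nonneg hF0 hH0 hσ _ _ _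
  have hdz : ∀ k, z k - zt k + σ • Bs (y k - yt k) = σ • r k := fun k => by
    rw [hzdef k, hr, map_sub]; module
  have hre : ∀ {xb yb}, As xb + Bs yb = c → ∀ k, As (x k - xb) + Bs (y k - yb) = r k :=
    fun hc k => by
      simp only [hr, map_sub, ← hc]
      abel
  have hsx : Summable fun k => qf Sfh (x k - xt k) := by
    refine (summable_nat_add_iff 2).1 (hxi.of_nonneg_of_le (fun k => hSfhpsd _) fun k => ?_)
    rw [qf_sub_comm]
    exact le_add_of_nonneg_right (hShhpsd _)
  have hsy : Summable fun k => qf Shh (y k - yt k) := by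
    refine (summable_nat_add_iff 1).1 (hxi.of_nonneg_of_le (fun k => hShhpsd _) fun k => ?_)
    rw [qf_sub_comm]
    exact le_add_of_nonneg_left (hSfhpsd _)
  have fejer : ∀ xb yb zb, IsSubgrad f2 (-gradient f1 xb - A zb) xb →
      IsSubgrad h2 (-gradient h1 yb - B zb) yb → As xb + Bs yb = c →
      (∃ l, Tendsto (fun k => energy F H Bs σ (xt k - xb) (yt k - yb) (zt k - zb)) atTop (𝓝 l))
        ∧ Tendsto D atTop (𝓝 0) := by
    intro xb yb zb hxb hyb hc
    have hstep := tendsto_of_decrease_le_summable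
      (V := fun k => energy F H Bs σ (xt k - xb) (yt k - yb) (zt k - zb))
      (D := fun k => ρ * (2 - ρ) * D k)
      (fun k => energy_nonneg hF0 hH0 hσ _ _ _) (fun k => mul_nonneg hρρ.le (hD0 k))
      (fun k => mul_nonneg hρ0.le (add_nonneg (hSfhpsd _) (hShhpsd _)))
      ((hsx.add hsy).mul_left ρ) fun k => by
        have hx := inner_prox_step_le hf0 hfupp (hfocx k) hxb
        have hy := inner_prox_step_le hh0 hhupp (hfocy k) hyb
        rw [← map_sub A] at hx
        rw [← map_sub B, add_sub_right_comm] at hy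
        have h := energy_step_le (dz := z k - zt k) hσ hFsa hHsa hA hB hρ0.le
          (by rw [hdz, hre hc]) hx (by rw [hre hc]; exact hy)
        simp only [sub_sub_sub_cancel_left] at h
        rw [hxt, hyt, hzt, add_sub_right_comm, add_sub_right_comm (yt k),
          add_sub_right_comm (zt k)]
        exact h
    refine ⟨hstep.1, ?_⟩
    simpa only [inv_mul_cancel_left₀ hρρ.ne', mul_zero] using
      hstep.2.const_mul (ρ * (2 - ρ))⁻¹
  obtain ⟨C, hC⟩ := exists_norm_sq_le_energy (Bs := Bs) hσ hA hF0 hTpd hFpd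
  obtain ⟨xb, yb, zb, hxb, hyb, hcb⟩ := hkkt
  have hDlim : Tendsto D atTop (𝓝 0) := (fejer xb yb zb hxb hyb hcb).2
  have hrlim : Tendsto (fun k => ‖r k‖ ^ 2) atTop (𝓝 0) := by
    refine squeeze_zero (fun _ => sq_nonneg _) (fun k => ?_)
      (by simpa using hDlim.const_mul σ⁻¹ : Tendsto (fun k => σ⁻¹ * D k) atTop (𝓝 0))
    have h := hF0 (x k - xt k)
    have h' := hH0 (y k - yt k)
    rw [← div_eq_inv_mul, le_div_iff₀' hσ]
    simp only [hD, energy, hdz, norm_smul, mul_pow, Real.norm_eq_abs, sq_abs]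
    rw [pow_two σ, mul_assoc, inv_mul_cancel_left₀ hσ.ne']
    linarith
  have hr0 : Tendsto r atTop (𝓝 0) :=
    tendsto_of_norm_sub_sq_le (fun k => by rw [sub_zero]) hrlim
  have hbound : ∀ xb yb zb, As xb + Bs yb = c → ∀ k,
      ‖x k - xb‖ ^ 2 + ‖y k - yb‖ ^ 2 + ‖z k - zb‖ ^ 2
        ≤ |C| * (2 * energy F H Bs σ (xt k - xb) (yt k - yb) (zt k - zb) + 2 * D k
          + ‖r k‖ ^ 2) := by
    intro xb yb zb hc k
    have h := hC (x k - xb) (y k - yb) (z k - zb)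
    have h2 := energy_add_le (Bs := Bs) hF0 hH0 hσ (xt k - xb) (x k - xt k) (yt k - yb)
      (y k - yt k) (zt k - zb) (z k - zt k)
    simp only [sub_add_sub_cancel'] at h2
    rw [hre hc] at h
    have h3 := energy_nonneg (Bs := Bs) hF0 hH0 hσ (x k - xb) (y k - yb) (z k - zb)
    refine h.trans ((mul_le_mul_of_nonneg_right (le_abs_self C) (by positivity)).trans ?_)
    exact mul_le_mul_of_nonneg_left (by linarith) (abs_nonneg C)
  -- A cluster point of the iterates.
  obtain ⟨⟨xs, ys, zs⟩, φ, hφ, hlim⟩ : ∃ (w : X × Y × Z) (φ : ℕ → ℕ), StrictMono φ ∧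
      Tendsto ((fun k => (x k, y k, z k)) ∘ φ) atTop (𝓝 w) := by
    obtain ⟨l, hl⟩ := (fejer xb yb zb hxb hyb hcb).1
    obtain ⟨M, hM⟩ := ((((hl.const_mul 2).add (hDlim.const_mul 2)).add hrlim).const_mul
      |C|).bddAbove_range
    have hb : ∀ k, ‖x k - xb‖ ^ 2 + ‖y k - yb‖ ^ 2 + ‖z k - zb‖ ^ 2 ≤ M := fun k =>
      (hbound xb yb zb hcb k).trans (hM ⟨k, rfl⟩)
    obtain ⟨w, -, φ, hφ, hw⟩ := tendsto_subseq_of_bounded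
      (Metric.isBounded_closedBall (x := (xb, yb, zb)) (r := √M))
      (x := fun k => (x k, y k, z k)) fun k => by
        rw [Metric.mem_closedBall, Prod.dist_eq, Prod.dist_eq, dist_eq_norm, dist_eq_norm,
          dist_eq_norm]
        have h := hb k
        refine max_le ?_ (max_le ?_ ?_) <;> refine Real.le_sqrt_of_sq_le ?_ <;>
          linarith [sq_nonneg ‖x k - xb‖, sq_nonneg ‖y k - yb‖, sq_nonneg ‖z k - zb‖]
    exact ⟨w, φ, hφ, hw⟩
  have hφt : Tendsto φ atTop atTop := hφ.tendsto_atTop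
  have hxs : Tendsto (fun k => x (φ k)) atTop (𝓝 xs) := (continuous_fst.tendsto _).comp hlim
  have hys : Tendsto (fun k => y (φ k)) atTop (𝓝 ys) :=
    ((continuous_fst.comp continuous_snd).tendsto _).comp hlim
  have hzs : Tendsto (fun k => z (φ k)) atTop (𝓝 zs) :=
    ((continuous_snd.comp continuous_snd).tendsto _).comp hlim
  have hDe : ∀ k, D k = qf F (x k - xt k) + qf H (y k - yt k)
      + σ⁻¹ * ‖z k - zt k + σ • Bs (y k - yt k)‖ ^ 2 := fun _ => rfl
  have hDz : ∀ k, 0 ≤ σ⁻¹ * ‖z k - zt k + σ • Bs (y k - yt k)‖ ^ 2 := fun _ => by positivity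
  have hFx : Tendsto (fun k => F (x k - xt k)) atTop (𝓝 0) :=
    tendsto_apply_of_qf F hFsa hF0 (squeeze_zero (fun k => hF0 _)
      (fun k => by linarith [hDe k, hDz k, hH0 (y k - yt k)]) hDlim)
  have hHy : Tendsto (fun k => H (y k - yt k)) atTop (𝓝 0) :=
    tendsto_apply_of_qf H hHsa hH0 (squeeze_zero (fun k => hH0 _)
      (fun k => by linarith [hDe k, hDz k, hF0 (x k - xt k)]) hDlim)
  have hkx : IsSubgrad f2 (-gradient f1 xs - A zs) xs :=
    isSubgrad_of_tendsto_prox_steps hf1d.continuous hf2c hf0 hfupp (fun k => hfocx (φ k)) hxs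
      ((A.continuous.tendsto _).comp hzs) (hFx.comp hφt) (hsx.tendsto_atTop_zero.comp hφt)
  have hky : IsSubgrad h2 (-gradient h1 ys - B zs) ys :=
    isSubgrad_of_tendsto_prox_steps hh1d.continuous hh2c hh0 hhupp (fun k => hfocy (φ k)) hys
      ((B.continuous.tendsto _).comp
        (by simpa using hzs.add ((hr0.comp hφt).const_smul σ)))
      (hHy.comp hφt) (hsy.tendsto_atTop_zero.comp hφt)
  have hkc : As xs + Bs ys = c := by
    have h : Tendsto (fun k => r (φ k)) atTop (𝓝 (As xs + Bs ys - c)) :=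
      (((As.continuous.tendsto _).comp hxs).add ((Bs.continuous.tendsto _).comp hys)).sub_const c
    exact sub_eq_zero.1 (tendsto_nhds_unique h (hr0.comp hφt))
  -- The energy relative to the cluster point vanishes along the subsequence, hence everywhere.
  obtain ⟨l, hl⟩ := (fejer xs ys zs hkx hky hkc).1
  have hP : Tendsto (fun k => energy F H Bs σ (x (φ k) - xs) (y (φ k) - ys) (z (φ k) - zs))
      atTop (𝓝 0) := by
    have h := (continuous_energy (F := F) (H := H) (Bs := Bs) (σ := σ)).tendsto
      ((xs, ys, zs) - (xs, ys, zs)) |>.comp (hlim.sub_const (xs, ys, zs))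
    simpa [energy, qf, Function.comp_def] using h
  have hV : Tendsto (fun k => energy F H Bs σ (xt (φ k) - xs) (yt (φ k) - ys) (zt (φ k) - zs))
      atTop (𝓝 0) := by
    refine squeeze_zero (fun k => energy_nonneg hF0 hH0 hσ _ _ _) (fun k => ?_)
      (by simpa using (hP.const_mul 2).add ((hDlim.comp hφt).const_mul 2))
    have h := energy_add_le (Bs := Bs) hF0 hH0 hσ (x (φ k) - xs) (-(x (φ k) - xt (φ k)))
      (y (φ k) - ys) (-(y (φ k) - yt (φ k))) (z (φ k) - zs) (-(z (φ k) - zt (φ k)))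
    rw [energy_neg] at h
    simp only [neg_sub, sub_add_sub_cancel'] at h
    exact h
  obtain rfl : l = 0 := tendsto_nhds_unique (hl.comp hφt) hV
  have hq := (((hl.const_mul 2).add (hDlim.const_mul 2)).add hrlim).const_mul |C|
  simp only [mul_zero, add_zero] at hq
  have hb := hbound xs ys zs hkc
  refine ⟨xs, ys, zs, ⟨hkx, hky, hkc⟩, Tendsto.prodMk_nhds ?_ (Tendsto.prodMk_nhds ?_ ?_)⟩ <;>
    refine tendsto_of_norm_sub_sq_le (fun k => ?_) hq <;>
    linarith [hb k, sq_nonneg ‖x k - xs‖, sq_nonneg ‖y k - ys‖, sq_nonneg ‖z k - zs‖]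
end
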